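/- arXiv:0710.1477 — 2 statements merged into one kernel-verified Lean document; each statement's English description precedes it below -/
import Mathlib

section
/- Let k be a commutative ring, V₀ and W₀ k-modules, and ∂, h : V₀ → V₀, p : V₀ → W₀, e : W₀ → V₀ k-linear maps satisfying ∂∘h + e∘p = id_{V₀}, p∘e = id_{W₀}, and h∘e = 0. Let V = V₀[[ν]] and W = W₀[[ν]] be the corresponding k[[ν]]-modules of formal power series, write ∂̂, ĥ, p̂, ê for the ν-linear extensions, and let D : V → V be any k[[ν]]-linear map with (D − ∂̂)(V) ⊆ νV. Then id_V + (D − ∂̂)∘ĥ is bijective, and the deformed homotopy h_q = ĥ ∘ (id_V + (D − ∂̂)∘ĥ)^{−1} and deformed restriction p_q = p̂ ∘ (id_V + (D − ∂̂)∘ĥ)^{−1} satisfy: (i) D∘h_q + ê∘p_q = id_V; (ii) p_q∘ê = id_W; (iii) h_q∘ê = 0. -/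
/-- The formal parameter `ν` acting as shift on `V₀[[ν]] = (ℕ → V₀)`. -/
def shiftSeq {V : Type*} [Zero V] (v : ℕ → V) : ℕ → V :=
  fun n => match n with
  | 0 => 0
  | Nat.succ m => v m

/-- The perturbation `id + (D − ∂̂) ∘ ĥ` of the identity, where `∂̂`, `ĥ` are the
coefficientwise (`ν`-linear) extensions of `∂` (here `bd`) and `h` (here `hcl`). -/
def deformedPerturbation {k V : Type*} [CommRing k] [AddCommGroup V] [Module k V]
    (bd hcl : V →ₗ[k] V) (D : (ℕ → V) →ₗ[k] (ℕ → V)) : (ℕ → V) → (ℕ → V) :=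
  fun v n => v n + (D (fun m => hcl (v m)) n - bd (hcl (v n)))

/-- The solution `x` of `x + N x = y`, when each coefficient `N x n` depends only on the
coefficients of `x` below `n`. -/
def solveCausal {V : Type*} [AddCommGroup V] (N : (ℕ → V) → (ℕ → V)) (y : ℕ → V) : ℕ → V :=
  fun n => y n - N (fun m => if m < n then solveCausal N y m else 0) n
termination_by n => n

theorem bijective_add_of_causal {V : Type*} [AddCommGroup V] (N : (ℕ → V) → (ℕ → V))
    (hN : ∀ (v w : ℕ → V) (n : ℕ), (∀ m < n, v m = w m) → N v n = N w n) :
    Function.Bijective (fun v n => v n + N v n) := by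
  constructor
  · intro v w hvw
    funext n
    induction n using Nat.strong_induction_on with
    | _ n ih =>
      have h : v n + N v n = w n + N w n := congrFun hvw n
      rw [hN v w n ih] at h
      exact add_right_cancel h
  · intro y
    refine ⟨solveCausal N y, ?_⟩
    funext n
    have h : N (fun m => if m < n then solveCausal N y m else 0) n = N (solveCausal N y) n :=
      hN _ _ n fun m hm => if_pos hm
    change solveCausal N y n + N (solveCausal N y) n = y n
    rw [← h, solveCausal, sub_add_cancel]

/-- A `ν`-linear deformation of `∂̂` acts on the leading coefficient of a series by `∂`. -/
theorem apply_of_forall_lt_eq_zero {k V : Type*} [CommRing k] [AddCommGroup V] [Module k V]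
    (bd : V →ₗ[k] V) (D : (ℕ → V) →ₗ[k] (ℕ → V))
    (hDshift : ∀ v : ℕ → V, D (shiftSeq v) = shiftSeq (D v))
    (hD0 : ∀ v : ℕ → V, D v 0 = bd (v 0)) (n : ℕ) (v : ℕ → V) (hv : ∀ m < n, v m = 0) :
    D v n = bd (v n) := by
  induction n generalizing v with
  | zero => exact hD0 v
  | succ n ih =>
    have hshift : v = shiftSeq fun m => v (m + 1) := by
      funext m
      cases m with
      | zero => exact hv 0 n.succ_pos
      | succ m => rfl
    calc D v (n + 1) = shiftSeq (D fun m => v (m + 1)) (n + 1) := by rw [← hDshift, ← hshift]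
      _ = bd (v (n + 1)) := ih _ fun m hm => hv (m + 1) (Nat.succ_lt_succ hm)

theorem deformedPerturbation_bijective {k V : Type*} [CommRing k] [AddCommGroup V] [Module k V]
    (bd hcl : V →ₗ[k] V) (D : (ℕ → V) →ₗ[k] (ℕ → V))
    (hDshift : ∀ v : ℕ → V, D (shiftSeq v) = shiftSeq (D v))
    (hD0 : ∀ v : ℕ → V, D v 0 = bd (v 0)) :
    Function.Bijective (deformedPerturbation bd hcl D) := by
  refine bijective_add_of_causal (fun v n => D (fun m => hcl (v m)) n - bd (hcl (v n))) ?_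
  intro v w n hvw
  have h := apply_of_forall_lt_eq_zero bd D hDshift hD0 n
    ((fun m => hcl (v m)) - fun m => hcl (w m)) fun m hm => by simp [hvw m hm]
  rw [map_sub, Pi.sub_apply, Pi.sub_apply, map_sub] at h
  exact sub_eq_sub_iff_sub_eq_sub.mpr h

theorem deformedPerturbation_of_hcl_eq_zero {k V : Type*} [CommRing k] [AddCommGroup V]
    [Module k V] (bd hcl : V →ₗ[k] V) (D : (ℕ → V) →ₗ[k] (ℕ → V)) (v : ℕ → V)
    (hv : ∀ n, hcl (v n) = 0) : deformedPerturbation bd hcl D v = v := by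
  funext n
  have h : (fun m => hcl (v m)) = 0 := funext hv
  rw [deformedPerturbation, h, map_zero, hv, map_zero, Pi.zero_apply, sub_zero, add_zero]

/-- **Deformation of a contracting homotopy (quantum Koszul operator, quantum homotopy and
quantum restriction).**  Let `k` be a commutative ring, `V₀`, `W₀` `k`-modules and
`∂ (= bd), h (= hcl) : V₀ → V₀`, `p : V₀ → W₀`, `e : W₀ → V₀` `k`-linear maps with
`∂∘h + e∘p = id`, `p∘e = id` and `h∘e = 0`.  Let `V = V₀[[ν]]`, `W = W₀[[ν]]` and let
`D : V → V` be `k[[ν]]`-linear (i.e. `k`-linear and commuting with the shift `ν`) with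
`(D − ∂̂)(V) ⊆ νV` (i.e. `(D v)₀ = ∂(v₀)`).  Then `F = id + (D − ∂̂)∘ĥ` is bijective,
and for its inverse `G = F⁻¹`, the deformed homotopy `h_q = ĥ∘G` and deformed restriction
`p_q = p̂∘G` satisfy (i) `D∘h_q + ê∘p_q = id`, (ii) `p_q∘ê = id`, (iii) `h_q∘ê = 0`. -/
theorem deformed_homotopy (k V W : Type*) [CommRing k] [AddCommGroup V] [Module k V]
    [AddCommGroup W] [Module k W]
    (bd hcl : V →ₗ[k] V) (p : V →ₗ[k] W) (e : W →ₗ[k] V)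
    (h1 : ∀ v : V, bd (hcl v) + e (p v) = v)
    (h2 : ∀ w : W, p (e w) = w)
    (h3 : ∀ w : W, hcl (e w) = 0)
    (D : (ℕ → V) →ₗ[k] (ℕ → V))
    (hDshift : ∀ v : ℕ → V, D (shiftSeq v) = shiftSeq (D v))
    (hD0 : ∀ v : ℕ → V, D v 0 = bd (v 0)) :
    Function.Bijective (deformedPerturbation bd hcl D) ∧
    ∀ G : (ℕ → V) → (ℕ → V),
      Function.LeftInverse G (deformedPerturbation bd hcl D) →
      Function.RightInverse G (deformedPerturbation bd hcl D) →
      (∀ (v : ℕ → V) (n : ℕ), D (fun m => hcl (G v m)) n + e (p (G v n)) = v n) ∧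
      (∀ (w : ℕ → W) (n : ℕ), p (G (fun m => e (w m)) n) = w n) ∧
      (∀ (w : ℕ → W) (n : ℕ), hcl (G (fun m => e (w m)) n) = 0) := by
  refine ⟨deformedPerturbation_bijective bd hcl D hDshift hD0, fun G hGl hGr => ?_⟩
  have hGe (w : ℕ → W) : G (fun m => e (w m)) = fun m => e (w m) := by
    have h := hGl fun m => e (w m)
    rwa [deformedPerturbation_of_hcl_eq_zero bd hcl D _ fun n => h3 (w n)] at h
  refine ⟨fun v n => ?_, fun w n => ?_, fun w n => ?_⟩
  · have h : G v n + (D (fun m => hcl (G v m)) n - bd (hcl (G v n))) = v n := congrFun (hGr v) n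
    rw [← h, eq_sub_of_add_eq' (h1 (G v n))]
    abel
  · rw [hGe, h2]
  · rw [hGe, h3]
end

section
/- Let m ≥ 1 and let Λ be a constant antisymmetric real m×m matrix. For smooth f, g ∈ C^∞(ℝ^m, ℝ) and r ≥ 0 define C_r(f, g) = Σ_{i₁,…,i_r, j₁,…,j_r = 1}^m Λ^{i₁ j₁} ⋯ Λ^{i_r j_r} (∂_{i₁} ⋯ ∂_{i_r} f)·(∂_{j₁} ⋯ ∂_{j_r} g), and define the Weyl–Moyal star product of formal series f = Σ_a ν^a f_a, g = Σ_b ν^b g_b ∈ C^∞(ℝ^m, ℝ)[[ν]] by f ⋆ g = Σ_{a,b,r} ν^{a+b+r} (1/(2^r r!)) C_r(f_a, g_b). Then ⋆ is associative: (f ⋆ g) ⋆ h = f ⋆ (g ⋆ h) for all f, g, h ∈ C^∞(ℝ^m, ℝ)[[ν]]. -/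
/-- The `r`-th bidifferential operator of the Weyl–Moyal star product for a constant
Poisson tensor `Λ` on `ℝ^m`:
`C_r(f, g) = Σ Λ^{i₁j₁} ⋯ Λ^{i_rj_r} (∂_{i₁}⋯∂_{i_r} f)·(∂_{j₁}⋯∂_{j_r} g)`. -/
noncomputable def moyalCr (m : ℕ) (Λ : Fin m → Fin m → ℝ) (r : ℕ)
    (f g : (Fin m → ℝ) → ℝ) : (Fin m → ℝ) → ℝ :=
  fun x => ∑ i : Fin r → Fin m, ∑ j : Fin r → Fin m,
    (∏ l : Fin r, Λ (i l) (j l)) *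
      (iteratedFDeriv ℝ r f x fun l => Pi.single (i l) (1 : ℝ)) *
      (iteratedFDeriv ℝ r g x fun l => Pi.single (j l) (1 : ℝ))

/-- The Weyl–Moyal star product of formal series `f = Σ ν^a f_a`, `g = Σ ν^b g_b` (encoded
as sequences `ℕ → C^∞(ℝ^m)`):  `f ⋆ g = Σ_{a,b,r} ν^{a+b+r} (1/(2^r r!)) C_r(f_a, g_b)`. -/
noncomputable def moyal (m : ℕ) (Λ : Fin m → Fin m → ℝ)
    (f g : ℕ → (Fin m → ℝ) → ℝ) : ℕ → (Fin m → ℝ) → ℝ :=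
  fun n x => ∑ r ∈ Finset.range (n + 1), ∑ a ∈ Finset.range (n - r + 1),
    (1 / ((2 : ℝ) ^ r * (r.factorial : ℝ))) * moyalCr m Λ r (f a) (g (n - r - a)) x

open TensorProduct

open Finset.HasAntidiagonal (antidiagonal)

section Algebraic

variable {R A ι : Type*} [CommRing R] [CommRing A] [Algebra R A] [Fintype ι]

/-- The operator `Σ Λ^{ij} ∂_i ⊗ ∂_j` on `A ⊗ A`. -/
noncomputable def poissonOp (Λ : ι → ι → R) (D : ι → Derivation R A A) :
    Module.End R (A ⊗[R] A) :=
  ∑ i, ∑ j, Λ i j • map (D i : A →ₗ[R] A) (D j : A →ₗ[R] A)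

/-- The operator `Σ Λ^{ij} ∂_i ⊗ ∂_j ⊗ 1` on `A ⊗ A ⊗ A`. -/
noncomputable def poissonOp₁₂ (Λ : ι → ι → R) (D : ι → Derivation R A A) :
    Module.End R (A ⊗[R] (A ⊗[R] A)) :=
  ∑ i, ∑ j, Λ i j • map (D i : A →ₗ[R] A) (map (D j : A →ₗ[R] A) LinearMap.id)

/-- The operator `Σ Λ^{ij} ∂_i ⊗ 1 ⊗ ∂_j` on `A ⊗ A ⊗ A`. -/
noncomputable def poissonOp₁₃ (Λ : ι → ι → R) (D : ι → Derivation R A A) :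
    Module.End R (A ⊗[R] (A ⊗[R] A)) :=
  ∑ i, ∑ j, Λ i j • map (D i : A →ₗ[R] A) (map LinearMap.id (D j : A →ₗ[R] A))

/-- The operator `Σ Λ^{ij} 1 ⊗ ∂_i ⊗ ∂_j` on `A ⊗ A ⊗ A`. -/
noncomputable def poissonOp₂₃ (Λ : ι → ι → R) (D : ι → Derivation R A A) :
    Module.End R (A ⊗[R] (A ⊗[R] A)) :=
  ∑ i, ∑ j, Λ i j • map (LinearMap.id : A →ₗ[R] A)
    (map (D i : A →ₗ[R] A) (D j : A →ₗ[R] A))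

/-- The bidifferential operator `μ ∘ Π^r`, where `Π` is `poissonOp` and `μ` the product. -/
noncomputable def bidiff (Λ : ι → ι → R) (D : ι → Derivation R A A) (r : ℕ) (f g : A) : A :=
  LinearMap.mul' R A ((poissonOp Λ D ^ r) (f ⊗ₜ g))

variable (R A) in
/-- Multiplication of the first two factors. -/
noncomputable def mulLeft : A ⊗[R] (A ⊗[R] A) →ₗ[R] A ⊗[R] A :=
  (LinearMap.mul' R A).rTensor A ∘ₗ (TensorProduct.assoc R A A A).symm.toLinearMap

variable (R A) in
/-- Multiplication of the last two factors. -/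
noncomputable def mulRight : A ⊗[R] (A ⊗[R] A) →ₗ[R] A ⊗[R] A :=
  (LinearMap.mul' R A).lTensor A

@[simp] lemma mulLeft_tmul (a b c : A) : mulLeft R A (a ⊗ₜ (b ⊗ₜ c)) = (a * b) ⊗ₜ c := by
  simp [mulLeft]

@[simp] lemma mulRight_tmul (a b c : A) : mulRight R A (a ⊗ₜ (b ⊗ₜ c)) = a ⊗ₜ (b * c) := by
  simp [mulRight]

variable (Λ : ι → ι → R) {D : ι → Derivation R A A}

lemma poissonOp_comp_mulLeft :
    poissonOp Λ D ∘ₗ mulLeft R A = mulLeft R A ∘ₗ (poissonOp₂₃ Λ D + poissonOp₁₃ Λ D) := by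
  refine TensorProduct.ext_threefold' fun a b c ↦ ?_
  simp [poissonOp, poissonOp₁₃, poissonOp₂₃, LinearMap.sum_apply, add_tmul, smul_add,
    Finset.sum_add_distrib, mul_comm b]

lemma poissonOp_comp_mulRight :
    poissonOp Λ D ∘ₗ mulRight R A = mulRight R A ∘ₗ (poissonOp₁₂ Λ D + poissonOp₁₃ Λ D) := by
  refine TensorProduct.ext_threefold' fun a b c ↦ ?_
  simp [poissonOp, poissonOp₁₃, poissonOp₁₂, LinearMap.sum_apply, tmul_add, smul_add,
    Finset.sum_add_distrib, mul_comm c, add_comm]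

lemma mul'_comp_mulLeft :
    LinearMap.mul' R A ∘ₗ mulLeft R A = LinearMap.mul' R A ∘ₗ mulRight R A :=
  TensorProduct.ext_threefold' fun a b c ↦ by simp [mul_assoc]

lemma poissonOp₂₃_eq_lTensor : poissonOp₂₃ Λ D = (poissonOp Λ D).lTensor A := by
  refine TensorProduct.ext_threefold' fun a b c ↦ ?_
  simp [poissonOp, poissonOp₂₃, LinearMap.sum_apply, tmul_sum]

lemma poissonOp₁₂_comp_assoc :
    poissonOp₁₂ Λ D ∘ₗ (TensorProduct.assoc R A A A).toLinearMap =
      (TensorProduct.assoc R A A A).toLinearMap ∘ₗ (poissonOp Λ D).rTensor A := by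
  refine TensorProduct.ext_threefold fun a b c ↦ ?_
  simp [poissonOp, poissonOp₁₂, LinearMap.sum_apply, sum_tmul, smul_tmul']

/-- Iterating an intertwining relation. -/
lemma LinearMap.pow_apply_of_comp_eq {M N : Type*} [AddCommGroup M] [Module R M]
    [AddCommGroup N] [Module R N] {φ : M →ₗ[R] N} {S : Module.End R N} {T : Module.End R M}
    (h : S ∘ₗ φ = φ ∘ₗ T) (r : ℕ) (x : M) : (S ^ r) (φ x) = φ ((T ^ r) x) := by
  induction r generalizing x with
  | zero => rfl
  | succ r ih =>
    rw [pow_succ, pow_succ, Module.End.mul_apply, Module.End.mul_apply, ← ih]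
    exact congrArg _ (LinearMap.congr_fun h x)

lemma bidiff_bidiff_left (r s : ℕ) (f g h : A) :
    bidiff Λ D s (bidiff Λ D r f g) h = LinearMap.mul' R A (mulRight R A
      (((poissonOp₂₃ Λ D + poissonOp₁₃ Λ D) ^ s * poissonOp₁₂ Λ D ^ r) (f ⊗ₜ (g ⊗ₜ h)))) := by
  have key : bidiff Λ D r f g ⊗ₜ[R] h =
      mulLeft R A ((poissonOp₁₂ Λ D ^ r) (f ⊗ₜ (g ⊗ₜ h))) := by
    have := LinearMap.pow_apply_of_comp_eq (poissonOp₁₂_comp_assoc Λ (D := D)) r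
      ((f ⊗ₜ g) ⊗ₜ h)
    rw [LinearEquiv.coe_coe, TensorProduct.assoc_tmul] at this
    rw [this, LinearMap.rTensor_pow]
    simp [mulLeft, bidiff]
  rw [bidiff, key, LinearMap.pow_apply_of_comp_eq (poissonOp_comp_mulLeft Λ)]
  exact LinearMap.congr_fun mul'_comp_mulLeft _

lemma bidiff_bidiff_right (r s : ℕ) (f g h : A) :
    bidiff Λ D s f (bidiff Λ D r g h) = LinearMap.mul' R A (mulRight R A
      (((poissonOp₁₂ Λ D + poissonOp₁₃ Λ D) ^ s * poissonOp₂₃ Λ D ^ r) (f ⊗ₜ (g ⊗ₜ h)))) := by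
  have key : f ⊗ₜ[R] bidiff Λ D r g h =
      mulRight R A ((poissonOp₂₃ Λ D ^ r) (f ⊗ₜ (g ⊗ₜ h))) := by
    rw [poissonOp₂₃_eq_lTensor, LinearMap.lTensor_pow]
    simp [mulRight, bidiff]
  rw [bidiff, key, LinearMap.pow_apply_of_comp_eq (poissonOp_comp_mulRight Λ)]
  rfl

lemma commute_poissonOp₁₂_poissonOp₁₃ (hD : ∀ i j a, D i (D j a) = D j (D i a)) :
    Commute (poissonOp₁₂ Λ D) (poissonOp₁₃ Λ D) := by
  refine Commute.sum_left _ _ _ fun i _ ↦ Commute.sum_left _ _ _ fun j _ ↦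
    Commute.sum_right _ _ _ fun k _ ↦ Commute.sum_right _ _ _ fun l _ ↦
      (Commute.smul_right ?_ _).smul_left _
  exact TensorProduct.ext_threefold' fun a b c ↦ by simp [hD i k]

lemma commute_poissonOp₁₂_poissonOp₂₃ (hD : ∀ i j a, D i (D j a) = D j (D i a)) :
    Commute (poissonOp₁₂ Λ D) (poissonOp₂₃ Λ D) := by
  refine Commute.sum_left _ _ _ fun i _ ↦ Commute.sum_left _ _ _ fun j _ ↦
    Commute.sum_right _ _ _ fun k _ ↦ Commute.sum_right _ _ _ fun l _ ↦
      (Commute.smul_right ?_ _).smul_left _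
  exact TensorProduct.ext_threefold' fun a b c ↦ by simp [hD j k]

lemma commute_poissonOp₁₃_poissonOp₂₃ (hD : ∀ i j a, D i (D j a) = D j (D i a)) :
    Commute (poissonOp₁₃ Λ D) (poissonOp₂₃ Λ D) := by
  refine Commute.sum_left _ _ _ fun i _ ↦ Commute.sum_left _ _ _ fun j _ ↦
    Commute.sum_right _ _ _ fun k _ ↦ Commute.sum_right _ _ _ fun l _ ↦
      (Commute.smul_right ?_ _).smul_left _
  exact TensorProduct.ext_threefold' fun a b c ↦ by simp [hD j l]

/-- Associativity of the Moyal product `μ ∘ exp Π`, in each degree of the formal parameter. -/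
theorem sum_choose_bidiff_assoc (hD : ∀ i j a, D i (D j a) = D j (D i a))
    (n : ℕ) (f g h : A) :
    ∑ p ∈ antidiagonal n, n.choose p.1 • bidiff Λ D p.1 (bidiff Λ D p.2 f g) h =
      ∑ p ∈ antidiagonal n, n.choose p.1 • bidiff Λ D p.1 f (bidiff Λ D p.2 g h) := by
  have h₁₂ : Commute (poissonOp₂₃ Λ D + poissonOp₁₃ Λ D) (poissonOp₁₂ Λ D) :=
    ((commute_poissonOp₁₂_poissonOp₂₃ Λ hD).add_right
      (commute_poissonOp₁₂_poissonOp₁₃ Λ hD)).symm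
  have h₂₃ : Commute (poissonOp₁₂ Λ D + poissonOp₁₃ Λ D) (poissonOp₂₃ Λ D) :=
    (commute_poissonOp₁₂_poissonOp₂₃ Λ hD).add_left (commute_poissonOp₁₃_poissonOp₂₃ Λ hD)
  have key : (poissonOp₂₃ Λ D + poissonOp₁₃ Λ D + poissonOp₁₂ Λ D) ^ n =
      (poissonOp₁₂ Λ D + poissonOp₁₃ Λ D + poissonOp₂₃ Λ D) ^ n := by
    congr 1; abel
  rw [h₁₂.add_pow', h₂₃.add_pow'] at key
  have := congrArg (fun T ↦ LinearMap.mul' R A (mulRight R A (T (f ⊗ₜ (g ⊗ₜ h))))) key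
  simpa only [LinearMap.sum_apply, LinearMap.smul_apply, map_sum, map_nsmul,
    ← bidiff_bidiff_left, ← bidiff_bidiff_right] using this

lemma bidiff_zero (f g : A) : bidiff Λ D 0 f g = f * g := by
  simp [bidiff]

lemma bidiff_succ (r : ℕ) (f g : A) :
    bidiff Λ D (r + 1) f g = ∑ i, ∑ j, Λ i j • bidiff Λ D r (D i f) (D j g) := by
  rw [bidiff, pow_succ, Module.End.mul_apply]
  nth_rw 2 [poissonOp]
  simp [LinearMap.sum_apply, bidiff]

lemma bidiff_sum_smul_left {κ : Type*} (s : Finset κ) (c : κ → R) (F : κ → A) (r : ℕ) (g : A) :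
    bidiff Λ D r (∑ k ∈ s, c k • F k) g = ∑ k ∈ s, c k • bidiff Λ D r (F k) g := by
  simp [bidiff, sum_tmul, ← smul_tmul']

lemma bidiff_sum_smul_right {κ : Type*} (s : Finset κ) (c : κ → R) (F : κ → A) (r : ℕ) (f : A) :
    bidiff Λ D r f (∑ k ∈ s, c k • F k) = ∑ k ∈ s, c k • bidiff Λ D r f (F k) := by
  simp [bidiff, tmul_sum]

end Algebraic

section Smooth

variable (E : Type*) [NormedAddCommGroup E] [NormedSpace ℝ E]

/-- The algebra of smooth real functions on `E`. -/
def smoothSubalgebra : Subalgebra ℝ (E → ℝ) where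
  carrier := {f | ContDiff ℝ (⊤ : ℕ∞) f}
  mul_mem' {f g} (hf : ContDiff ℝ (⊤ : ℕ∞) f) (hg : ContDiff ℝ (⊤ : ℕ∞) g) := hf.mul hg
  add_mem' {f g} (hf : ContDiff ℝ (⊤ : ℕ∞) f) (hg : ContDiff ℝ (⊤ : ℕ∞) g) := hf.add hg
  algebraMap_mem' c := show ContDiff ℝ (⊤ : ℕ∞) (fun _ : E ↦ c) from contDiff_const

variable {E}

lemma contDiff_coe_smooth (f : smoothSubalgebra E) : ContDiff ℝ (⊤ : ℕ∞) (f : E → ℝ) :=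
  f.2

lemma differentiableAt_coe_smooth (f : smoothSubalgebra E) (x : E) :
    DifferentiableAt ℝ (f : E → ℝ) x :=
  ((contDiff_coe_smooth f).differentiable (by simp)).differentiableAt

/-- The directional derivative along a constant vector, on smooth functions. -/
noncomputable def dirDeriv (v : E) :
    Derivation ℝ (smoothSubalgebra E) (smoothSubalgebra E) :=
  Derivation.mk'
    { toFun f := ⟨fun x ↦ fderiv ℝ (f : E → ℝ) x v,
        ((contDiff_coe_smooth f).fderiv_right (m := (⊤ : ℕ∞)) (by simp)).clm_apply contDiff_const⟩
      map_add' f g := by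
        ext x
        simp [fderiv_add (differentiableAt_coe_smooth f x) (differentiableAt_coe_smooth g x)]
      map_smul' c f := by
        ext x
        simp [fderiv_const_smul (differentiableAt_coe_smooth f x)] }
    fun f g ↦ by
      ext x
      simp [fderiv_mul (differentiableAt_coe_smooth f x) (differentiableAt_coe_smooth g x)]

lemma dirDeriv_apply (v : E) (f : smoothSubalgebra E) (x : E) :
    (dirDeriv v f : E → ℝ) x = fderiv ℝ (f : E → ℝ) x v := rfl

lemma dirDeriv_comm (v w : E) (f : smoothSubalgebra E) :
    dirDeriv v (dirDeriv w f) = dirDeriv w (dirDeriv v f) := by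
  have hd (x : E) : DifferentiableAt ℝ (fderiv ℝ (f : E → ℝ)) x :=
    (((contDiff_coe_smooth f).fderiv_right (m := (⊤ : ℕ∞)) (by simp)).differentiable
      (by simp)).differentiableAt
  have key (u u' x : E) : (dirDeriv u (dirDeriv u' f) : E → ℝ) x =
      fderiv ℝ (fderiv ℝ (f : E → ℝ)) x u u' := by
    change fderiv ℝ (fun y ↦ fderiv ℝ (f : E → ℝ) y u') x u = _
    rw [fderiv_clm_apply (hd x) (differentiableAt_const _)]
    simp
  ext x
  rw [key, key]
  exact ((contDiff_coe_smooth f).contDiffAt.isSymmSndFDerivAt (by simpa using WithTop.coe_le_coe.2 (le_top : (2 : ℕ∞) ≤ ⊤))) v w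

lemma iteratedFDeriv_succ_snoc (f : smoothSubalgebra E) (n : ℕ) (x : E) (w : Fin n → E) (v : E) :
    iteratedFDeriv ℝ (n + 1) (f : E → ℝ) x (Fin.snoc (α := fun _ ↦ E) w v) =
      iteratedFDeriv ℝ n (dirDeriv v f : E → ℝ) x w := by
  rw [iteratedFDeriv_succ_apply_right, Fin.init_snoc, Fin.snoc_last,
    ← iteratedFDeriv_clm_apply_const_apply
      ((contDiff_coe_smooth f).fderiv_right (m := (⊤ : ℕ∞)) (by simp)) (by exact_mod_cast le_top)]
  rfl

end Smooth

section Antidiagonal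

/-- Reindexing of the sum over the compositions of `n` in a product bracketed to the left. -/
lemma sum_antidiagonal_nested_left {M : Type*} [AddCommMonoid M] (F : ℕ → ℕ → ℕ → ℕ → ℕ → M)
    (n : ℕ) :
    ∑ p ∈ antidiagonal n, ∑ q ∈ antidiagonal p.2, ∑ t ∈ antidiagonal q.1,
        ∑ u ∈ antidiagonal t.2, F p.1 t.1 u.1 u.2 q.2 =
      ∑ t ∈ antidiagonal n, ∑ u ∈ antidiagonal t.2, ∑ v ∈ antidiagonal u.2,
        ∑ p ∈ antidiagonal t.1, F p.1 p.2 u.1 v.1 v.2 := by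
  simp only [Finset.sum_sigma']
  refine Finset.sum_nbij'
    (fun ⟨p, q, t, u⟩ ↦ ⟨(p.1 + t.1, u.1 + u.2 + q.2), (u.1, u.2 + q.2), (u.2, q.2), (p.1, t.1)⟩)
    (fun ⟨t, u, v, p⟩ ↦ ⟨(p.1, p.2 + u.1 + v.1 + v.2), (p.2 + u.1 + v.1, v.2),
      (p.2, u.1 + v.1), (u.1, v.1)⟩) ?_ ?_ ?_ ?_ ?_
  · rintro ⟨⟨a, b⟩, ⟨c, d⟩, ⟨i, j⟩, ⟨k, l⟩⟩ hx
    simp only [Finset.mem_sigma, Finset.HasAntidiagonal.mem_antidiagonal] at hx ⊢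
    refine ⟨?_, ?_, ?_, ?_⟩ <;> (try dsimp only) <;> omega
  · rintro ⟨⟨a, b⟩, ⟨c, d⟩, ⟨i, j⟩, ⟨k, l⟩⟩ hx
    simp only [Finset.mem_sigma, Finset.HasAntidiagonal.mem_antidiagonal] at hx ⊢
    refine ⟨?_, ?_, ?_, ?_⟩ <;> (try dsimp only) <;> omega
  · rintro ⟨⟨a, b⟩, ⟨c, d⟩, ⟨i, j⟩, ⟨k, l⟩⟩ hx
    simp only [Finset.mem_sigma, Finset.HasAntidiagonal.mem_antidiagonal] at hx
    obtain ⟨rfl, rfl, rfl, rfl⟩ := hx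
    simp [add_assoc]
  · rintro ⟨⟨a, b⟩, ⟨c, d⟩, ⟨i, j⟩, ⟨k, l⟩⟩ hx
    simp only [Finset.mem_sigma, Finset.HasAntidiagonal.mem_antidiagonal] at hx
    obtain ⟨rfl, rfl, rfl, rfl⟩ := hx
    simp [add_assoc]
  · rintro ⟨⟨a, b⟩, ⟨c, d⟩, ⟨i, j⟩, ⟨k, l⟩⟩ -
    rfl

/-- Reindexing of the sum over the compositions of `n` in a product bracketed to the right. -/
lemma sum_antidiagonal_nested_right {M : Type*} [AddCommMonoid M] (F : ℕ → ℕ → ℕ → ℕ → ℕ → M)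
    (n : ℕ) :
    ∑ p ∈ antidiagonal n, ∑ q ∈ antidiagonal p.2, ∑ t ∈ antidiagonal q.2,
        ∑ u ∈ antidiagonal t.2, F p.1 t.1 q.1 u.1 u.2 =
      ∑ t ∈ antidiagonal n, ∑ u ∈ antidiagonal t.2, ∑ v ∈ antidiagonal u.2,
        ∑ p ∈ antidiagonal t.1, F p.1 p.2 u.1 v.1 v.2 := by
  simp only [Finset.sum_sigma']
  refine Finset.sum_nbij'
    (fun ⟨p, q, t, u⟩ ↦ ⟨(p.1 + t.1, q.1 + u.1 + u.2), (q.1, u.1 + u.2), u, (p.1, t.1)⟩)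
    (fun ⟨t, u, v, p⟩ ↦ ⟨(p.1, p.2 + u.1 + v.1 + v.2), (u.1, p.2 + v.1 + v.2),
      (p.2, v.1 + v.2), v⟩) ?_ ?_ ?_ ?_ ?_
  · rintro ⟨⟨a, b⟩, ⟨c, d⟩, ⟨i, j⟩, ⟨k, l⟩⟩ hx
    simp only [Finset.mem_sigma, Finset.HasAntidiagonal.mem_antidiagonal] at hx ⊢
    refine ⟨?_, ?_, ?_, ?_⟩ <;> (try dsimp only) <;> omega
  · rintro ⟨⟨a, b⟩, ⟨c, d⟩, ⟨i, j⟩, ⟨k, l⟩⟩ hx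
    simp only [Finset.mem_sigma, Finset.HasAntidiagonal.mem_antidiagonal] at hx ⊢
    refine ⟨?_, ?_, ?_, ?_⟩ <;> (try dsimp only) <;> omega
  · rintro ⟨⟨a, b⟩, ⟨c, d⟩, ⟨i, j⟩, ⟨k, l⟩⟩ hx
    simp only [Finset.mem_sigma, Finset.HasAntidiagonal.mem_antidiagonal] at hx
    obtain ⟨rfl, rfl, rfl, rfl⟩ := hx
    simp [add_assoc, add_left_comm]
  · rintro ⟨⟨a, b⟩, ⟨c, d⟩, ⟨i, j⟩, ⟨k, l⟩⟩ hx
    simp only [Finset.mem_sigma, Finset.HasAntidiagonal.mem_antidiagonal] at hx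
    obtain ⟨rfl, rfl, rfl, rfl⟩ := hx
    simp [add_assoc]
  · rintro ⟨⟨a, b⟩, ⟨c, d⟩, ⟨i, j⟩, ⟨k, l⟩⟩ -
    rfl

end Antidiagonal

section Moyal

variable {m : ℕ} (Λ : Fin m → Fin m → ℝ)

/-- The coordinate derivations on smooth functions on `ℝ^m`. -/
noncomputable def coordDeriv (i : Fin m) :
    Derivation ℝ (smoothSubalgebra (Fin m → ℝ)) (smoothSubalgebra (Fin m → ℝ)) :=
  dirDeriv (Pi.single i 1)

lemma moyalCr_succ (r : ℕ) (f g : smoothSubalgebra (Fin m → ℝ)) (x : Fin m → ℝ) :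
    moyalCr m Λ (r + 1) f g x =
      ∑ i, ∑ j, Λ i j * moyalCr m Λ r (coordDeriv i f) (coordDeriv j g) x := by
  have hsum (F : (Fin (r + 1) → Fin m) → ℝ) :
      ∑ i, F i = ∑ k, ∑ i, F (Fin.snoc (α := fun _ ↦ Fin m) i k) := by
    rw [← Equiv.sum_comp (Fin.snocEquiv fun _ : Fin (r + 1) ↦ Fin m) F]
    exact Fintype.sum_prod_type _
  have hs (i : Fin r → Fin m) (k : Fin m) :
      (fun l ↦ Pi.single (Fin.snoc (α := fun _ ↦ Fin m) i k l) (1 : ℝ)) =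
        Fin.snoc (α := fun _ ↦ Fin m → ℝ) (fun l ↦ Pi.single (i l) 1) (Pi.single k 1) := by
    ext l : 1
    refine Fin.lastCases ?_ (fun l ↦ ?_) l <;> simp
  unfold moyalCr
  simp_rw [hsum, Finset.mul_sum]
  refine Finset.sum_congr rfl fun k _ ↦ ?_
  rw [Finset.sum_comm]
  refine Finset.sum_congr rfl fun l _ ↦ Finset.sum_congr rfl fun i _ ↦
    Finset.sum_congr rfl fun j _ ↦ ?_
  simp only [hs, iteratedFDeriv_succ_snoc, Fin.prod_univ_castSucc, coordDeriv, Fin.snoc_castSucc,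
    Fin.snoc_last]
  ring

lemma moyalCr_eq_bidiff (r : ℕ) (f g : smoothSubalgebra (Fin m → ℝ)) (x : Fin m → ℝ) :
    moyalCr m Λ r f g x = (bidiff Λ coordDeriv r f g : smoothSubalgebra (Fin m → ℝ)).1 x := by
  induction r generalizing f g with
  | zero => simp [moyalCr, bidiff_zero]
  | succ r ih => simp [moyalCr_succ, bidiff_succ, ih, Finset.sum_apply]

/-- The coefficient `1 / (2^r r!)` of the Moyal product. -/
noncomputable def moyalCoeff (r : ℕ) : ℝ := 1 / ((2 : ℝ) ^ r * (r.factorial : ℝ))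

lemma moyalCoeff_mul_moyalCoeff {n : ℕ} {p : ℕ × ℕ} (hp : p ∈ antidiagonal n) :
    moyalCoeff p.1 * moyalCoeff p.2 = moyalCoeff n * n.choose p.1 := by
  obtain ⟨r, s⟩ := p
  obtain rfl : r + s = n := by simpa using hp
  have h : ((r + s).choose r : ℝ) * r.factorial * s.factorial = (r + s).factorial := by
    rw [Nat.choose_symm_add]
    exact_mod_cast Nat.add_choose_mul_factorial_mul_factorial r s
  have := Nat.factorial_pos r
  have := Nat.factorial_pos s
  have := Nat.factorial_pos (r + s)
  simp only [moyalCoeff]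
  field_simp
  rw [← h]
  ring

/-- The Moyal product on sequences of smooth functions. -/
noncomputable def smoothMoyal (f g : ℕ → smoothSubalgebra (Fin m → ℝ)) (n : ℕ) :
    smoothSubalgebra (Fin m → ℝ) :=
  ∑ p ∈ antidiagonal n, ∑ q ∈ antidiagonal p.2,
    moyalCoeff p.1 • bidiff Λ coordDeriv p.1 (f q.1) (g q.2)

lemma moyal_eq_smoothMoyal (f g : ℕ → smoothSubalgebra (Fin m → ℝ)) :
    moyal m Λ (fun n ↦ f n) (fun n ↦ g n) = fun n ↦ (smoothMoyal Λ f g n : (Fin m → ℝ) → ℝ) := by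
  ext n x
  simp [moyal, smoothMoyal, Finset.Nat.sum_antidiagonal_eq_sum_range_succ_mk, Finset.sum_apply,
    moyalCr_eq_bidiff, moyalCoeff]

lemma smoothMoyal_assoc (f g h : ℕ → smoothSubalgebra (Fin m → ℝ)) :
    smoothMoyal Λ (smoothMoyal Λ f g) h = smoothMoyal Λ f (smoothMoyal Λ g h) := by
  have key (n a b c : ℕ) : ∑ p ∈ antidiagonal n, (moyalCoeff p.1 * moyalCoeff p.2) •
        bidiff Λ coordDeriv p.1 (bidiff Λ coordDeriv p.2 (f a) (g b)) (h c) =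
      ∑ p ∈ antidiagonal n, (moyalCoeff p.1 * moyalCoeff p.2) •
        bidiff Λ coordDeriv p.1 (f a) (bidiff Λ coordDeriv p.2 (g b) (h c)) := by
    have := congrArg (moyalCoeff n • ·) (sum_choose_bidiff_assoc Λ
      (D := coordDeriv) (fun i j a ↦ dirDeriv_comm _ _ a) n (f a) (g b) (h c))
    simp only [Finset.smul_sum] at this
    convert this using 2 with p hp p hp <;>
      rw [moyalCoeff_mul_moyalCoeff hp, mul_smul, Nat.cast_smul_eq_nsmul]
  ext1 n
  have hl : smoothMoyal Λ (smoothMoyal Λ f g) h n =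
      ∑ t ∈ antidiagonal n, ∑ u ∈ antidiagonal t.2,
        ∑ v ∈ antidiagonal u.2, ∑ p ∈ antidiagonal t.1,
          (moyalCoeff p.1 * moyalCoeff p.2) • bidiff Λ coordDeriv p.1
            (bidiff Λ coordDeriv p.2 (f u.1) (g v.1)) (h v.2) := by
    rw [← sum_antidiagonal_nested_left fun r s a b c ↦ (moyalCoeff r * moyalCoeff s) •
      bidiff Λ coordDeriv r (bidiff Λ coordDeriv s (f a) (g b)) (h c)]
    simp only [smoothMoyal, Finset.sum_sigma', bidiff_sum_smul_left, Finset.smul_sum, mul_smul]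
  have hr : smoothMoyal Λ f (smoothMoyal Λ g h) n =
      ∑ t ∈ antidiagonal n, ∑ u ∈ antidiagonal t.2,
        ∑ v ∈ antidiagonal u.2, ∑ p ∈ antidiagonal t.1,
          (moyalCoeff p.1 * moyalCoeff p.2) • bidiff Λ coordDeriv p.1 (f u.1)
            (bidiff Λ coordDeriv p.2 (g v.1) (h v.2)) := by
    rw [← sum_antidiagonal_nested_right fun r s a b c ↦ (moyalCoeff r * moyalCoeff s) •
      bidiff Λ coordDeriv r (f a) (bidiff Λ coordDeriv s (g b) (h c))]
    simp only [smoothMoyal, Finset.sum_sigma', bidiff_sum_smul_right, Finset.smul_sum, mul_smul]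
  simp only [hl, hr, key]

end Moyal

/-- **Associativity of the Weyl–Moyal star product.**  For `m ≥ 1` and a constant
antisymmetric real `m×m` matrix `Λ`, the Weyl–Moyal star product is associative on formal
power series with smooth coefficients. -/
theorem moyal_assoc (m : ℕ) (hm : 1 ≤ m) (Λ : Fin m → Fin m → ℝ)
    (hΛ : ∀ i j, Λ i j = - Λ j i)
    (f g h : ℕ → (Fin m → ℝ) → ℝ)
    (hf : ∀ n, ContDiff ℝ (⊤ : ℕ∞) (f n)) (hg : ∀ n, ContDiff ℝ (⊤ : ℕ∞) (g n))
    (hh : ∀ n, ContDiff ℝ (⊤ : ℕ∞) (h n)) :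
    moyal m Λ (moyal m Λ f g) h = moyal m Λ f (moyal m Λ g h) := by
  lift f to ℕ → smoothSubalgebra (Fin m → ℝ) using hf
  lift g to ℕ → smoothSubalgebra (Fin m → ℝ) using hg
  lift h to ℕ → smoothSubalgebra (Fin m → ℝ) using hh
  rw [moyal_eq_smoothMoyal, moyal_eq_smoothMoyal, moyal_eq_smoothMoyal, moyal_eq_smoothMoyal,
    smoothMoyal_assoc]
end
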